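/- arXiv:2009.04665 — 2 statements merged into one kernel-verified Lean document; each statement's English description precedes it below -/
import Mathlib

section
/- Let (M, dist) be a metric space equipped with a Borel measure μ, let f : M → ℝ be a measurable function, and let R : M → ℝ be a measurable nonnegative function. Fix α ∈ (0,1). Suppose there are constants C > 0 and r₁ ≥ 1 such that μ({x | f(x) ≤ s}) ≥ C·s for all s ≥ r₁, μ({x | f(x) ≤ r₁}) < ∞, and R(x) ≥ C₁·f(x)^{-α} whenever f(x) ≥ r₁ (for some constant C₁ > 0). Then there exist constants C' > 0 and r₂ ≥ r₁ such that for all r ≥ r₂ the lower Lebesgue integral satisfies ∫⁻_{ {x | f(x) ≤ r} } R dμ ≥ C'·r^{1-α}. (This is the measure-theoretic content of Proposition 3.2 of the paper: if the scalar curvature decays like r^{-α} and sublevel sets of the potential have at least linear measure growth, then the curvature integral over Σ_{≤r} grows at least like r^{1-α}.) -/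
open MeasureTheory

/-- Proposition 3.2 (measure-theoretic content): if the "curvature" `R` decays no faster
than `f ^ (-α)` and the sublevel sets of `f` have at least linear measure growth, then
the integral of `R` over the sublevel set `{f ≤ r}` grows at least like `r ^ (1 - α)`. -/
theorem curvature_integral_lower_bound
    {M : Type*} [MetricSpace M] [MeasurableSpace M] [BorelSpace M]
    (μ : Measure M) (f R : M → ℝ) (hfm : Measurable f) (hRm : Measurable R)
    (hRnn : ∀ x, 0 ≤ R x)
    (α : ℝ) (hα : α ∈ Set.Ioo (0 : ℝ) 1)
    (C r₁ : ℝ) (hC : 0 < C) (hr₁ : 1 ≤ r₁)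
    (hμ : ∀ s, r₁ ≤ s → ENNReal.ofReal (C * s) ≤ μ {x | f x ≤ s})
    (hfin : μ {x | f x ≤ r₁} < ⊤)
    (C₁ : ℝ) (hC₁ : 0 < C₁)
    (hRlb : ∀ x, r₁ ≤ f x → C₁ * (f x) ^ (-α) ≤ R x) :
    ∃ C' r₂ : ℝ, 0 < C' ∧ r₁ ≤ r₂ ∧ ∀ r, r₂ ≤ r →
      ENNReal.ofReal (C' * r ^ (1 - α)) ≤
        ∫⁻ x in {x | f x ≤ r}, ENNReal.ofReal (R x) ∂μ := by
  set m : ℝ := (μ {x | f x ≤ r₁}).toReal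
  refine ⟨C₁ * (C / 2), max r₁ (2 * m / C), by positivity, le_max_left _ _, fun r hr => ?_⟩
  have hr₁r : r₁ ≤ r := (le_max_left _ _).trans hr
  have hr0 : 0 < r := by linarith
  have hmr : m ≤ C / 2 * r := by
    have h := (div_le_iff₀ hC).1 ((le_max_right _ _).trans hr)
    linarith
  have hshell : ENNReal.ofReal (C / 2 * r) ≤ μ {x | r₁ < f x ∧ f x ≤ r} := by
    have hsub : {x | f x ≤ r} ⊆ {x | f x ≤ r₁} ∪ {x | r₁ < f x ∧ f x ≤ r} := fun x hx =>
      (le_or_gt (f x) r₁).imp id fun h => ⟨h, hx⟩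
    have hinner : μ {x | f x ≤ r₁} ≤ ENNReal.ofReal (C / 2 * r) :=
      (ENNReal.le_ofReal_iff_toReal_le hfin.ne (by positivity)).2 hmr
    refine (ENNReal.add_le_add_iff_left (a := ENNReal.ofReal (C / 2 * r))
      ENNReal.ofReal_ne_top).1 ?_
    calc ENNReal.ofReal (C / 2 * r) + ENNReal.ofReal (C / 2 * r)
        = ENNReal.ofReal (C * r) := by
          rw [← ENNReal.ofReal_add (by positivity) (by positivity)]
          congr 1
          ring
      _ ≤ μ {x | f x ≤ r} := hμ r hr₁r
      _ ≤ μ {x | f x ≤ r₁} + μ {x | r₁ < f x ∧ f x ≤ r} :=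
          (measure_mono hsub).trans (measure_union_le _ _)
      _ ≤ ENNReal.ofReal (C / 2 * r) + μ {x | r₁ < f x ∧ f x ≤ r} := by gcongr
  have hmeas : MeasurableSet {x | r₁ < f x ∧ f x ≤ r} :=
    (measurableSet_lt measurable_const hfm).inter (measurableSet_le hfm measurable_const)
  calc ENNReal.ofReal (C₁ * (C / 2) * r ^ (1 - α))
      = ENNReal.ofReal (C₁ * r ^ (-α)) * ENNReal.ofReal (C / 2 * r) := by
        rw [← ENNReal.ofReal_mul (by positivity), sub_eq_add_neg, Real.rpow_add hr0,
          Real.rpow_one]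
        congr 1
        ring
    _ ≤ ENNReal.ofReal (C₁ * r ^ (-α)) * μ {x | r₁ < f x ∧ f x ≤ r} := by gcongr
    _ = ∫⁻ _ in {x | r₁ < f x ∧ f x ≤ r}, ENNReal.ofReal (C₁ * r ^ (-α)) ∂μ :=
        (setLIntegral_const _ _).symm
    _ ≤ ∫⁻ x in {x | r₁ < f x ∧ f x ≤ r}, ENNReal.ofReal (R x) ∂μ := by
        refine setLIntegral_mono' hmeas fun x hx => ENNReal.ofReal_le_ofReal ?_
        refine le_trans ?_ (hRlb x hx.1.le)
        exact mul_le_mul_of_nonneg_left (Real.rpow_le_rpow_of_nonpos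
          (by linarith [hx.1]) hx.2 (by linarith [hα.1])) hC₁.le
    _ ≤ ∫⁻ x in {x | f x ≤ r}, ENNReal.ofReal (R x) ∂μ :=
        lintegral_mono_set fun x hx => hx.2
end

section
/- Let (M, dist) be a metric space equipped with a Borel measure μ, let f : M → ℝ be a measurable function, and let R : M → ℝ be a measurable nonnegative function. Fix real numbers α ∈ (0,1) and β > α. Suppose there are constants C > 0 and r₁ ≥ 1 such that μ({x | f(x) ≤ s}) ≥ C·s^{β} for all s ≥ r₁, μ({x | f(x) ≤ r₁}) < ∞, and R(x) ≥ C₁·f(x)^{-α} whenever f(x) ≥ r₁ (for some constant C₁ > 0). Then there exist constants C' > 0 and r₂ ≥ r₁ such that for all r ≥ r₂ the lower Lebesgue integral satisfies ∫⁻_{ {x | f(x) ≤ r} } R dμ ≥ C'·r^{β-α}. (This is the general step of the iteration in the proof of Theorem 1.1 of the paper: each improved polynomial lower bound μ(Σ_{≤r}) ≥ C r^{β} upgrades the curvature-integral lower bound to C' r^{β-α}.) -/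
open MeasureTheory

/-- The general iteration step in the proof of Theorem 1.1: a polynomial lower bound
`μ {f ≤ s} ≥ C s ^ β` together with the decay lower bound `R ≥ C₁ f ^ (-α)` upgrades the
curvature-integral lower bound over `{f ≤ r}` to `C' r ^ (β - α)`. -/
theorem curvature_integral_iteration_step
    {M : Type*} [MetricSpace M] [MeasurableSpace M] [BorelSpace M]
    (μ : Measure M) (f R : M → ℝ) (hfm : Measurable f) (hRm : Measurable R)
    (hRnn : ∀ x, 0 ≤ R x)
    (α β : ℝ) (hα : α ∈ Set.Ioo (0 : ℝ) 1) (hβ : α < β)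
    (C r₁ : ℝ) (hC : 0 < C) (hr₁ : 1 ≤ r₁)
    (hμ : ∀ s, r₁ ≤ s → ENNReal.ofReal (C * s ^ β) ≤ μ {x | f x ≤ s})
    (hfin : μ {x | f x ≤ r₁} < ⊤)
    (C₁ : ℝ) (hC₁ : 0 < C₁)
    (hRlb : ∀ x, r₁ ≤ f x → C₁ * (f x) ^ (-α) ≤ R x) :
    ∃ C' r₂ : ℝ, 0 < C' ∧ r₁ ≤ r₂ ∧ ∀ r, r₂ ≤ r →
      ENNReal.ofReal (C' * r ^ (β - α)) ≤
        ∫⁻ x in {x | f x ≤ r}, ENNReal.ofReal (R x) ∂μ := by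
  obtain ⟨hα0, -⟩ := hα
  set m : ℝ := (μ {x | f x ≤ r₁}).toReal
  have hm_eq : μ {x | f x ≤ r₁} = ENNReal.ofReal m := (ENNReal.ofReal_toReal hfin.ne).symm
  obtain ⟨r₀, hr₀⟩ := Filter.eventually_atTop.1
    ((tendsto_rpow_atTop (hα0.trans hβ)).eventually_ge_atTop (2 * m / C))
  refine ⟨C₁ * (C / 2), max r₁ r₀, by positivity, le_max_left _ _, fun r hr => ?_⟩
  have hr₁r : r₁ ≤ r := (le_max_left _ _).trans hr
  have hrpos : 0 < r := by linarith
  have hmr : 2 * m ≤ r ^ β * C := (div_le_iff₀ hC).1 (hr₀ r ((le_max_right _ _).trans hr))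
  -- At least half of the guaranteed measure of `{f ≤ r}` lies outside `{f ≤ r₁}`.
  have hannulus : ENNReal.ofReal (C / 2 * r ^ β) ≤ μ {x | r₁ < f x ∧ f x ≤ r} := by
    have hunion : μ {x | f x ≤ r} ≤ μ {x | r₁ < f x ∧ f x ≤ r} + μ {x | f x ≤ r₁} := by
      refine (measure_mono fun x hx => ?_).trans (measure_union_le _ _)
      rcases lt_or_ge r₁ (f x) with h | h
      · exact Or.inl ⟨h, hx⟩
      · exact Or.inr h
    calc ENNReal.ofReal (C / 2 * r ^ β)
        ≤ ENNReal.ofReal (C * r ^ β - m) := ENNReal.ofReal_le_ofReal (by linarith)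
      _ = ENNReal.ofReal (C * r ^ β) - ENNReal.ofReal m :=
          ENNReal.ofReal_sub _ ENNReal.toReal_nonneg
      _ ≤ μ {x | r₁ < f x ∧ f x ≤ r} :=
          tsub_le_iff_right.2 (hm_eq ▸ (hμ r hr₁r).trans hunion)
  have hmeas : MeasurableSet {x | r₁ < f x ∧ f x ≤ r} :=
    (measurableSet_lt measurable_const hfm).inter (measurableSet_le hfm measurable_const)
  calc ENNReal.ofReal (C₁ * (C / 2) * r ^ (β - α))
      = ENNReal.ofReal (C₁ * r ^ (-α)) * ENNReal.ofReal (C / 2 * r ^ β) := by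
        rw [← ENNReal.ofReal_mul (by positivity), sub_eq_add_neg, Real.rpow_add hrpos]
        congr 1
        ring
    _ ≤ ENNReal.ofReal (C₁ * r ^ (-α)) * μ {x | r₁ < f x ∧ f x ≤ r} := by gcongr
    _ = ∫⁻ _ in {x | r₁ < f x ∧ f x ≤ r}, ENNReal.ofReal (C₁ * r ^ (-α)) ∂μ :=
        (setLIntegral_const _ _).symm
    _ ≤ ∫⁻ x in {x | r₁ < f x ∧ f x ≤ r}, ENNReal.ofReal (R x) ∂μ := by
        refine setLIntegral_mono' hmeas fun x hx => ENNReal.ofReal_le_ofReal ?_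
        refine le_trans ?_ (hRlb x hx.1.le)
        exact mul_le_mul_of_nonneg_left
          (Real.rpow_le_rpow_of_nonpos (by linarith [hx.1]) hx.2 (by linarith)) hC₁.le
    _ ≤ ∫⁻ x in {x | f x ≤ r}, ENNReal.ofReal (R x) ∂μ :=
        lintegral_mono_set fun x hx => hx.2
end
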